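/- Let U ⊆ ℝ² be a connected, simply connected open neighborhood of (0,0), let E, G : U → ℝ be smooth with E > 0, E(0,0) = 1, G(0,0) = 0 and dG(0,0) ≠ 0, and let X, Y, Z : U → ℝ be smooth functions satisfying the Gauss–Codazzi equations (C1), (C2), (G) on U. Let w₁, w₂, w₃ ∈ ℝ³ be a null basis, i.e. ⟨w₁, w₁⟩ = ⟨w₂, w₃⟩ = 1 and ⟨w₁, w₂⟩ = ⟨w₁, w₃⟩ = ⟨w₂, w₂⟩ = ⟨w₃, w₃⟩ = 0. Then there exists a unique pair of smooth maps f : U → 𝕃³ and ψ : U → ℝ³ such that: ⟨f_u, f_u⟩ = E, ⟨f_u, f_v⟩ = 0, ⟨f_v, f_v⟩ = G; ⟨ψ, ψ⟩ = 0, ⟨ψ, f_u⟩ = 0, ⟨ψ, f_v⟩ = 1; ⟨f_uu, ψ⟩ = X, ⟨f_uv, ψ⟩ = Y, ⟨f_vv, ψ⟩ = Z; f(0,0) = 0; and f_u(0,0) = w₁, f_v(0,0) = w₂, ψ(0,0) = w₃. -/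

import Mathlib

noncomputable section

/-- The Minkowski inner product of signature (+,+,−) on ℝ³. -/
def mink (x y : Fin 3 → ℝ) : ℝ := x 0 * y 0 + x 1 * y 1 - x 2 * y 2

/-- The Lorentzian vector product `v × w = S (v ×ₑ w)`, `S = diag(1,1,−1)`. -/
def lcross (v w : Fin 3 → ℝ) : Fin 3 → ℝ :=
  ![v 1 * w 2 - v 2 * w 1, v 2 * w 0 - v 0 * w 2, -(v 0 * w 1 - v 1 * w 0)]

/-- Partial derivative in the first coordinate direction. -/
def pu {E : Type*} [NormedAddCommGroup E] [NormedSpace ℝ E]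
    (f : ℝ × ℝ → E) (q : ℝ × ℝ) : E :=
  fderiv ℝ f q (1, 0)

/-- Partial derivative in the second coordinate direction. -/
def pv {E : Type*} [NormedAddCommGroup E] [NormedSpace ℝ E]
    (f : ℝ × ℝ → E) (q : ℝ × ℝ) : E :=
  fderiv ℝ f q (0, 1)

section FrameTheory

open Set Metric Topology
open scoped ContDiff

section PartialDerivatives

variable {V : Type*} [NormedAddCommGroup V] [NormedSpace ℝ V]

/-- `F` is differentiable at `q` with first partial derivative `a` and second one `b`. -/
def HasPartialsAt (F : ℝ × ℝ → V) (a b : V) (q : ℝ × ℝ) : Prop :=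
  HasFDerivAt F ((ContinuousLinearMap.fst ℝ ℝ ℝ).smulRight a +
    (ContinuousLinearMap.snd ℝ ℝ ℝ).smulRight b) q

theorem HasPartialsAt.pu_eq {F : ℝ × ℝ → V} {a b : V} {q : ℝ × ℝ}
    (h : HasPartialsAt F a b q) : pu F q = a := by
  simp [pu, HasFDerivAt.fderiv h]

theorem HasPartialsAt.pv_eq {F : ℝ × ℝ → V} {a b : V} {q : ℝ × ℝ}
    (h : HasPartialsAt F a b q) : pv F q = b := by
  simp [pv, HasFDerivAt.fderiv h]

theorem DifferentiableAt.hasPartialsAt {F : ℝ × ℝ → V} {q : ℝ × ℝ}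
    (h : DifferentiableAt ℝ F q) : HasPartialsAt F (pu F q) (pv F q) q := by
  refine h.hasFDerivAt.congr_fderiv ?_
  ext <;> simp [pu, pv]

theorem HasPartialsAt.differentiableAt {F : ℝ × ℝ → V} {a b : V} {q : ℝ × ℝ}
    (h : HasPartialsAt F a b q) : DifferentiableAt ℝ F q :=
  HasFDerivAt.differentiableAt h

end PartialDerivatives

section LinearODE

theorem norm_le_of_norm_deriv_le_mul_norm_add {V : Type*} [NormedAddCommGroup V]
    [NormedSpace ℝ V] {D D' : ℝ → V} {t₀ r K ε : ℝ} (hr : 0 ≤ r) (hKr : K * r ≤ 1 / 2)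
    (hK : 0 ≤ K)
    (hD : ∀ t ∈ Icc (t₀ - r) (t₀ + r), HasDerivWithinAt D (D' t) (Icc (t₀ - r) (t₀ + r)) t)
    (hb : ∀ t ∈ Icc (t₀ - r) (t₀ + r), ‖D' t‖ ≤ K * ‖D t‖ + ε) :
    ∀ t ∈ Icc (t₀ - r) (t₀ + r), ‖D t‖ ≤ 2 * (‖D t₀‖ + r * ε) := by
  have h0 : t₀ ∈ Icc (t₀ - r) (t₀ + r) := ⟨by linarith, by linarith⟩
  have hc : ContinuousOn (fun t => ‖D t‖) (Icc (t₀ - r) (t₀ + r)) :=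
    (fun t ht => (hD t ht).continuousWithinAt.norm)
  obtain ⟨m, hm, hmax⟩ := isCompact_Icc.exists_isMaxOn ⟨t₀, h0⟩ hc
  have hε : 0 ≤ K * ‖D m‖ + ε := (norm_nonneg _).trans (hb m hm)
  have key : ‖D m - D t₀‖ ≤ (K * ‖D m‖ + ε) * ‖m - t₀‖ := by
    refine (convex_Icc _ _).norm_image_sub_le_of_norm_hasDerivWithin_le hD (fun t ht => ?_) h0 hm
    refine (hb t ht).trans ?_
    have : ‖D t‖ ≤ ‖D m‖ := hmax ht
    gcongr
  have hmr : ‖m - t₀‖ ≤ r := by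
    rw [Real.norm_eq_abs, abs_le]; constructor <;> linarith [hm.1, hm.2]
  have h1 : ‖D m‖ ≤ ‖D t₀‖ + (K * ‖D m‖ + ε) * r := by
    have h2 := norm_sub_norm_le (D m) (D t₀)
    have h3 := mul_le_mul_of_nonneg_left hmr hε
    linarith
  intro t ht
  have h4 : ‖D t‖ ≤ ‖D m‖ := hmax ht
  have h5 := mul_le_mul_of_nonneg_right hKr (norm_nonneg (D m))
  linarith

theorem exists_hasDerivWithinAt_mul {𝔸 : Type*} [NormedRing 𝔸] [NormedAlgebra ℝ 𝔸]
    [CompleteSpace 𝔸] {C : ℝ → 𝔸} {t₀ r K : ℝ} (hr : 0 ≤ r) (hK : 0 ≤ K) (hKr : K * r ≤ 1 / 2)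
    (hC : ContinuousOn C (Icc (t₀ - r) (t₀ + r)))
    (hb : ∀ t ∈ Icc (t₀ - r) (t₀ + r), ‖C t‖ ≤ K) (x₀ : 𝔸) :
    ∃ α : ℝ → 𝔸, α t₀ = x₀ ∧ ∀ t ∈ Icc (t₀ - r) (t₀ + r),
      HasDerivWithinAt α (C t * α t) (Icc (t₀ - r) (t₀ + r)) t := by
  have h0 : t₀ ∈ Icc (t₀ - r) (t₀ + r) := ⟨by linarith, by linarith⟩
  lift K to NNReal using hK
  have : IsPicardLindelof (fun t x => C t * x) (⟨t₀, h0⟩ : Icc (t₀ - r) (t₀ + r)) x₀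
      ‖x₀‖₊ 0 (K * (2 * ‖x₀‖₊)) K := by
    refine ⟨fun t ht => ?_, fun x _ => hC.mul continuousOn_const, fun t ht x hx => ?_, ?_⟩
    · refine LipschitzOnWith.of_dist_le_mul fun x _ y _ => ?_
      rw [dist_eq_norm, dist_eq_norm, ← mul_sub]
      exact (norm_mul_le _ _).trans (by gcongr; exact hb t ht)
    · have hx2 : ‖x‖ ≤ 2 * ‖x₀‖ := by
        have h1 := norm_sub_norm_le x x₀
        have h2 : ‖x - x₀‖ ≤ ‖x₀‖ := by simpa [dist_eq_norm] using hx
        linarith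
      refine (norm_mul_le _ _).trans ?_
      push_cast
      exact mul_le_mul (hb t ht) hx2 (norm_nonneg _) K.2
    · have h1 := mul_le_mul_of_nonneg_right hKr (norm_nonneg x₀)
      simp only [add_sub_cancel_left, sub_sub_cancel, max_self]
      push_cast
      linarith
  exact this.exists_eq_forall_mem_Icc_hasDerivWithinAt₀

end LinearODE

section LocalExistence

variable {𝔸 : Type*} [NormedRing 𝔸] [NormedAlgebra ℝ 𝔸]

theorem mem_closedBall_prod_real_iff {p q : ℝ × ℝ} {r : ℝ} :
    q ∈ closedBall p r ↔
      q.1 ∈ Icc (p.1 - r) (p.1 + r) ∧ q.2 ∈ Icc (p.2 - r) (p.2 + r) := by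
  rw [← closedBall_prod_same p.1 p.2 r, mem_prod, Real.closedBall_eq_Icc, Real.closedBall_eq_Icc]

theorem hasDerivAt_fst_of_differentiableAt {V : Type*} [NormedAddCommGroup V] [NormedSpace ℝ V]
    {F : ℝ × ℝ → V} {u v : ℝ} (h : DifferentiableAt ℝ F (u, v)) :
    HasDerivAt (fun t => F (t, v)) (pu F (u, v)) u := by
  have h1 : HasDerivAt (fun t : ℝ => (t, v)) ((1 : ℝ), (0 : ℝ)) u :=
    (hasDerivAt_id u).prodMk (hasDerivAt_const u v)
  exact h.hasFDerivAt.comp_hasDerivAt u h1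

theorem hasDerivAt_snd_of_differentiableAt {V : Type*} [NormedAddCommGroup V] [NormedSpace ℝ V]
    {F : ℝ × ℝ → V} {u v : ℝ} (h : DifferentiableAt ℝ F (u, v)) :
    HasDerivAt (fun t => F (u, t)) (pv F (u, v)) v := by
  have h1 : HasDerivAt (fun t : ℝ => (u, t)) ((0 : ℝ), (1 : ℝ)) v :=
    (hasDerivAt_const v u).prodMk (hasDerivAt_id v)
  exact h.hasFDerivAt.comp_hasDerivAt v h1

/-- First-order Taylor estimate along the first coordinate for a function whose derivative is
`M`-Lipschitz on a box. -/
theorem norm_sub_sub_smul_pu_le {V : Type*} [NormedAddCommGroup V] [NormedSpace ℝ V]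
    {B : ℝ × ℝ → V} {p : ℝ × ℝ} {r M : ℝ} (hM : 0 ≤ M)
    (hB : ∀ q ∈ closedBall p r, DifferentiableAt ℝ B q)
    (hLB : ∀ q ∈ closedBall p r, ∀ q' ∈ closedBall p r,
      ‖fderiv ℝ B q - fderiv ℝ B q'‖ ≤ M * ‖q - q'‖)
    {u u₀ v : ℝ} (hu : (u, v) ∈ closedBall p r) (hu₀ : (u₀, v) ∈ closedBall p r) :
    ‖B (u, v) - B (u₀, v) - (u - u₀) • pu B (u₀, v)‖ ≤ M * |u - u₀| * |u - u₀| := by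
  have hs : segment ℝ (u₀, v) (u, v) ⊆ closedBall p r :=
    (convex_closedBall p r).segment_subset hu₀ hu
  have := (convex_segment (𝕜 := ℝ) (u₀, v) (u, v)).norm_image_sub_le_of_norm_fderiv_le' (𝕜 := ℝ)
    (f := B) (φ := fderiv ℝ B (u₀, v)) (C := M * |u - u₀|) (fun q hq => hB q (hs hq))
    (fun q hq => ?_) (left_mem_segment ℝ _ _) (right_mem_segment ℝ _ _)
  · have h1 : ((u, v) : ℝ × ℝ) - (u₀, v) = (u - u₀) • ((1 : ℝ), (0 : ℝ)) := by simp
    rw [h1, map_smul] at this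
    simpa [pu, Prod.norm_def] using this
  · refine (hLB q (hs hq) _ hu₀).trans ?_
    have h2 : ‖q - (u₀, v)‖ ≤ ‖((u, v) : ℝ × ℝ) - (u₀, v)‖ := by
      have := norm_sub_le_of_mem_segment hq
      exact this
    have h3 : ‖((u, v) : ℝ × ℝ) - (u₀, v)‖ = |u - u₀| := by simp [Prod.norm_def]
    rw [h3] at h2
    gcongr

variable [CompleteSpace 𝔸] {A B : ℝ × ℝ → 𝔸} {p : ℝ × ℝ}

/-- Solvability of the overdetermined linear system `F_u = A F`, `F_v = B F` with zero curvature
on a box that is small compared with the size of the coefficients. -/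
theorem exists_hasPartialsAt_mul_of_bounds {r K M : ℝ} (hr : 0 < r) (hK : 0 ≤ K)
    (hKr : K * r ≤ 1 / 2) (hM : 0 ≤ M)
    (hAK : ∀ q ∈ closedBall p r, ‖A q‖ ≤ K) (hBK : ∀ q ∈ closedBall p r, ‖B q‖ ≤ K)
    (hA : ∀ q ∈ closedBall p r, DifferentiableAt ℝ A q)
    (hB : ∀ q ∈ closedBall p r, DifferentiableAt ℝ B q)
    (hBM : ∀ q ∈ closedBall p r, ‖fderiv ℝ B q‖ ≤ M)
    (hLB : ∀ q ∈ closedBall p r, ∀ q' ∈ closedBall p r,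
      ‖fderiv ℝ B q - fderiv ℝ B q'‖ ≤ M * ‖q - q'‖)
    (hflat : ∀ q ∈ closedBall p r, pv A q + A q * B q = pu B q + B q * A q) :
    ∃ F : ℝ × ℝ → 𝔸, F p = 1 ∧ ∀ q ∈ ball p r, HasPartialsAt F (A q * F q) (B q * F q) q := by
  obtain ⟨a, b⟩ := p
  have hmem : ∀ {u v : ℝ}, u ∈ Icc (a - r) (a + r) → v ∈ Icc (b - r) (b + r) →
      (u, v) ∈ closedBall (a, b) r := fun hu hv => mem_closedBall_prod_real_iff.2 ⟨hu, hv⟩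
  have ha : a ∈ Icc (a - r) (a + r) := ⟨by linarith, by linarith⟩
  have hb : b ∈ Icc (b - r) (b + r) := ⟨by linarith, by linarith⟩
  obtain ⟨g, hg0, hg⟩ := exists_hasDerivWithinAt_mul (C := fun t => A (t, b)) (t₀ := a) hr.le hK hKr
    (fun t ht => (hasDerivAt_fst_of_differentiableAt
      (hA _ (hmem ht hb))).continuousAt.continuousWithinAt)
    (fun t ht => hAK _ (hmem ht hb)) 1
  have hex : ∀ u : ℝ, ∃ α : ℝ → 𝔸, α b = g u ∧ (u ∈ Icc (a - r) (a + r) →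
      ∀ t ∈ Icc (b - r) (b + r),
        HasDerivWithinAt α (B (u, t) * α t) (Icc (b - r) (b + r)) t) := by
    intro u
    by_cases hu : u ∈ Icc (a - r) (a + r)
    · obtain ⟨α, h0, h1⟩ := exists_hasDerivWithinAt_mul (C := fun t => B (u, t)) (t₀ := b) hr.le hK
        hKr (fun t ht => (hasDerivAt_snd_of_differentiableAt
          (hB _ (hmem hu ht))).continuousAt.continuousWithinAt)
        (fun t ht => hBK _ (hmem hu ht)) (g u)
      exact ⟨α, h0, fun _ => h1⟩
    · exact ⟨fun _ => g u, rfl, fun h => absurd h hu⟩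
  choose f hfb hf using hex
  refine ⟨fun q => f q.1 q.2, by simp [hfb, hg0], ?_⟩
  rintro ⟨u₀, v₀⟩ hq₀
  have hq₀' : u₀ ∈ Ioo (a - r) (a + r) ∧ v₀ ∈ Ioo (b - r) (b + r) := by
    rwa [← ball_prod_same, Real.ball_eq_Ioo, Real.ball_eq_Ioo] at hq₀
  have hu₀ := Ioo_subset_Icc_self hq₀'.1
  have hv₀ := Ioo_subset_Icc_self hq₀'.2
  have hfN := norm_le_of_norm_deriv_le_mul_norm_add (ε := 0) hr.le hKr hK (hf u₀ hu₀)
    (fun t ht => (norm_mul_le _ _).trans (by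
      rw [add_zero]; have := hBK _ (hmem hu₀ ht); gcongr))
  set N : ℝ := 2 * (‖f u₀ b‖ + r * 0) with hN
  have hN0 : 0 ≤ N := by positivity
  let D : ℝ → ℝ → 𝔸 := fun u v => f u v - f u₀ v - (u - u₀) • (A (u₀, v) * f u₀ v)
  have hD : ∀ u ∈ Icc (a - r) (a + r), ∀ v ∈ Icc (b - r) (b + r),
      ‖D u v‖ ≤ 2 * (‖D u b‖ + r * (M * (1 + K) * N * (u - u₀) ^ 2)) := by
    intro u hu
    refine norm_le_of_norm_deriv_le_mul_norm_add hr.le hKr hK (D' := fun v =>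
      B (u, v) * f u v - B (u₀, v) * f u₀ v - (u - u₀) •
        (pv A (u₀, v) * f u₀ v + A (u₀, v) * (B (u₀, v) * f u₀ v))) (fun v hv => ?_)
      (fun v hv => ?_)
    · have h1 := (hasDerivAt_snd_of_differentiableAt (hA _ (hmem hu₀ hv))).hasDerivWithinAt.mul
        (hf u₀ hu₀ v hv)
      exact ((hf u hu v hv).sub (hf u₀ hu₀ v hv)).sub (h1.const_smul (u - u₀))
    · have hfl := hflat _ (hmem hu₀ hv)
      have hid : B (u, v) * f u v - B (u₀, v) * f u₀ v - (u - u₀) •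
          (pv A (u₀, v) * f u₀ v + A (u₀, v) * (B (u₀, v) * f u₀ v)) =
          B (u, v) * D u v + ((B (u, v) - B (u₀, v) - (u - u₀) • pu B (u₀, v)) * f u₀ v +
            (u - u₀) • ((B (u, v) - B (u₀, v)) * A (u₀, v) * f u₀ v)) := by
        rw [← mul_assoc, ← add_mul, hfl]
        simp only [D, mul_sub, sub_mul, add_mul, mul_smul_comm, smul_mul_assoc, smul_add, smul_sub,
          mul_assoc]
        abel
      rw [hid]
      have hT := norm_sub_sub_smul_pu_le hM hB hLB (hmem hu hv) (hmem hu₀ hv)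
      have hB1 : ‖B (u, v) - B (u₀, v)‖ ≤ M * |u - u₀| := by
        have := (convex_closedBall (a, b) r).norm_image_sub_le_of_norm_fderiv_le (𝕜 := ℝ) hB hBM
          (hmem hu₀ hv) (hmem hu hv)
        simpa [Prod.norm_def] using this
      have hx1 : ‖(B (u, v) - B (u₀, v) - (u - u₀) • pu B (u₀, v)) * f u₀ v‖ ≤
          M * |u - u₀| * |u - u₀| * N := by
        refine (norm_mul_le _ _).trans ?_
        have := hfN v hv
        gcongr
      have hx2 : ‖(u - u₀) • ((B (u, v) - B (u₀, v)) * A (u₀, v) * f u₀ v)‖ ≤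
          |u - u₀| * (M * |u - u₀| * K * N) := by
        rw [norm_smul, Real.norm_eq_abs]
        have h1 := hfN v hv
        have h2 := hAK _ (hmem hu₀ hv)
        refine mul_le_mul_of_nonneg_left ?_ (abs_nonneg _)
        refine (norm_mul_le _ _).trans ?_
        have h3 : ‖(B (u, v) - B (u₀, v)) * A (u₀, v)‖ ≤ M * |u - u₀| * K :=
          (norm_mul_le _ _).trans (by gcongr)
        gcongr
      have hx3 : ‖B (u, v) * D u v‖ ≤ K * ‖D u v‖ := by
        refine (norm_mul_le _ _).trans ?_
        have := hBK _ (hmem hu hv)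
        gcongr
      have hsq : |u - u₀| * |u - u₀| = (u - u₀) ^ 2 := by rw [← pow_two, sq_abs]
      calc _ ≤ K * ‖D u v‖ + (M * |u - u₀| * |u - u₀| * N + |u - u₀| * (M * |u - u₀| * K * N)) :=
            norm_add_le_of_le hx3 (norm_add_le_of_le hx1 hx2)
        _ = _ := by rw [← hsq]; ring
  have hgd : HasDerivAt g (A (u₀, b) * g u₀) u₀ :=
    (hg u₀ hu₀).hasDerivAt (Icc_mem_nhds hq₀'.1.1 hq₀'.1.2)
  have hfd : HasDerivAt (f u₀) (B (u₀, v₀) * f u₀ v₀) v₀ :=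
    (hf u₀ hu₀ v₀ hv₀).hasDerivAt (Icc_mem_nhds hq₀'.2.1 hq₀'.2.2)
  have hAd := (hasDerivAt_snd_of_differentiableAt (hA _ (hmem hu₀ hv₀))).mul hfd
  have hrem : HasFDerivAt (fun q : ℝ × ℝ => D q.1 q.2) (0 : ℝ × ℝ →L[ℝ] 𝔸) (u₀, v₀) := by
    rw [hasFDerivAt_iff_isLittleO]
    have h1 : (fun q : ℝ × ℝ => D q.1 b) =o[𝓝 (u₀, v₀)] fun q => q.1 - u₀ := by
      have := (hasDerivAt_iff_isLittleO.1 hgd).comp_tendsto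
        (continuous_fst.tendsto ((u₀, v₀) : ℝ × ℝ))
      simpa only [D, hfb, Function.comp_def] using this
    have h2 : (fun q : ℝ × ℝ => (q.1 - u₀) ^ 2) =o[𝓝 (u₀, v₀)] fun q => q.1 - u₀ := by
      refine Asymptotics.isLittleO_pow_id one_lt_two |>.comp_tendsto
        (k := fun q : ℝ × ℝ => q.1 - u₀) ?_
      have : Continuous fun q : ℝ × ℝ => q.1 - u₀ := by fun_prop
      simpa using this.tendsto (u₀, v₀)
    have h3 : (fun q : ℝ × ℝ => q.1 - u₀) =O[𝓝 (u₀, v₀)] fun q => q - (u₀, v₀) :=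
      Asymptotics.isBigO_of_le _ fun q => norm_fst_le (q - (u₀, v₀))
    have h4 : (fun q : ℝ × ℝ => 2 * (‖D q.1 b‖ + r * (M * (1 + K) * N * (q.1 - u₀) ^ 2)))
        =o[𝓝 (u₀, v₀)] fun q => q - (u₀, v₀) :=
      (((h1.norm_left.add ((h2.const_mul_left _).const_mul_left _)).const_mul_left
        2).trans_isBigO h3)
    refine (Asymptotics.IsBigO.of_norm_eventuallyLE ?_).trans_isLittleO h4
    filter_upwards [closedBall_mem_nhds_of_mem hq₀] with q hq
    rw [mem_closedBall_prod_real_iff] at hq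
    simpa [D] using hD q.1 hq.1 q.2 hq.2
  have hsnd : HasFDerivAt (Prod.snd : ℝ × ℝ → ℝ) (ContinuousLinearMap.snd ℝ ℝ ℝ) (u₀, v₀) :=
    hasFDerivAt_snd
  have hterm1 : HasFDerivAt (fun q : ℝ × ℝ => f u₀ q.2)
      ((ContinuousLinearMap.snd ℝ ℝ ℝ).smulRight (B (u₀, v₀) * f u₀ v₀)) (u₀, v₀) := by
    refine (hfd.hasFDerivAt.comp (u₀, v₀) hsnd).congr_fderiv ?_
    ext <;> simp
  have hterm2 : HasFDerivAt (fun q : ℝ × ℝ => (q.1 - u₀) • (A (u₀, q.2) * f u₀ q.2))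
      ((ContinuousLinearMap.fst ℝ ℝ ℝ).smulRight (A (u₀, v₀) * f u₀ v₀)) (u₀, v₀) := by
    have h1 : HasFDerivAt (fun q : ℝ × ℝ => q.1 - u₀) (ContinuousLinearMap.fst ℝ ℝ ℝ) (u₀, v₀) :=
      hasFDerivAt_fst.sub_const u₀
    have h2 := hAd.hasFDerivAt.comp (u₀, v₀) hsnd
    refine (h1.smul h2).congr_fderiv ?_
    ext <;> simp
  have hsum := (hterm1.add hterm2).add hrem
  have heq : (fun q : ℝ × ℝ => f q.1 q.2) = (((fun q : ℝ × ℝ => f u₀ q.2) +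
      fun q : ℝ × ℝ => (q.1 - u₀) • (A (u₀, q.2) * f u₀ q.2)) +
      fun q : ℝ × ℝ => D q.1 q.2) := by
    funext q
    simp [D]
  unfold HasPartialsAt
  rw [heq]
  refine hsum.congr_fderiv ?_
  ext <;> simp [D]

end LocalExistence

section LocalFundamentalSolution

variable {𝔸 : Type*} [NormedRing 𝔸] [NormedAlgebra ℝ 𝔸] [CompleteSpace 𝔸] {A B : ℝ × ℝ → 𝔸}

theorem exists_isUnit_hasPartialsAt_mul {U : Set (ℝ × ℝ)} (hU : IsOpen U)
    (hA : ContDiffOn ℝ ∞ A U) (hB : ContDiffOn ℝ ∞ B U)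
    (hflat : ∀ q ∈ U, pv A q + A q * B q = pu B q + B q * A q) {p : ℝ × ℝ} (hp : p ∈ U) :
    ∃ r > 0, ball p r ⊆ U ∧ ∃ F : ℝ × ℝ → 𝔸, F p = 1 ∧
      ∀ q ∈ ball p r, IsUnit (F q) ∧ HasPartialsAt F (A q * F q) (B q * F q) q := by
  have hUp := hU.mem_nhds hp
  have hBp := hB.contDiffAt hUp
  have hdB : ContDiffAt ℝ 1 (fderiv ℝ B) p := hBp.fderiv_right (by norm_cast)
  obtain ⟨M, t, ht, hL⟩ := hdB.exists_lipschitzOnWith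
  have hev : ∀ᶠ q in 𝓝 p, q ∈ U ∧ q ∈ t ∧ ‖A q‖ < ‖A p‖ + ‖B p‖ + 1 ∧
      ‖B q‖ < ‖A p‖ + ‖B p‖ + 1 ∧ ‖fderiv ℝ B q‖ < ‖fderiv ℝ B p‖ + 1 := by
    refine Filter.Eventually.and hUp (Filter.Eventually.and ht
      (Filter.Eventually.and ?_ (Filter.Eventually.and ?_ ?_)))
    · exact (hA.contDiffAt hUp).continuousAt.norm.eventually_lt_const
        (by linarith [norm_nonneg (B p)])
    · exact hBp.continuousAt.norm.eventually_lt_const (by linarith [norm_nonneg (A p)])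
    · exact hdB.continuousAt.norm.eventually_lt_const (lt_add_one _)
  obtain ⟨s, hs, hsub⟩ := nhds_basis_closedBall.eventually_iff.1 hev
  set K := ‖A p‖ + ‖B p‖ + 1 with hKdef
  have hK : 0 < K := by positivity
  have hr : 0 < min s (1 / (2 * K)) := by positivity
  have hcb : closedBall p (min s (1 / (2 * K))) ⊆ closedBall p s :=
    closedBall_subset_closedBall (min_le_left _ _)
  obtain ⟨F, hF1, hF⟩ := exists_hasPartialsAt_mul_of_bounds (A := A) (B := B) (p := p)
    (M := max M (‖fderiv ℝ B p‖ + 1)) hr hK.le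
    (by
      have := mul_le_mul_of_nonneg_left (min_le_right s (1 / (2 * K))) hK.le
      refine this.trans (le_of_eq ?_)
      field_simp)
    (le_max_of_le_left M.2)
    (fun q hq => (hsub (hcb hq)).2.2.1.le) (fun q hq => (hsub (hcb hq)).2.2.2.1.le)
    (fun q hq => (hA.contDiffAt (hU.mem_nhds (hsub (hcb hq)).1)).differentiableAt (by simp))
    (fun q hq => (hB.contDiffAt (hU.mem_nhds (hsub (hcb hq)).1)).differentiableAt (by simp))
    (fun q hq => (hsub (hcb hq)).2.2.2.2.le.trans (le_max_right _ _))
    (fun q hq q' hq' => by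
      have := hL.dist_le_mul q (hsub (hcb hq)).2.1 q' (hsub (hcb hq')).2.1
      rw [dist_eq_norm, dist_eq_norm] at this
      exact this.trans (mul_le_mul_of_nonneg_right (le_max_left _ _) (norm_nonneg _)))
    (fun q hq => hflat q (hsub (hcb hq)).1)
  have hunit : ∀ᶠ q in 𝓝 p, IsUnit (F q) := by
    have hc : ContinuousAt F p := (hF p (mem_ball_self hr)).differentiableAt.continuousAt
    refine hc.eventually (Units.isOpen.mem_nhds ?_)
    simp [hF1]
  obtain ⟨s', hs', hsub'⟩ := nhds_basis_ball.eventually_iff.1 hunit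
  refine ⟨min s' (min s (1 / (2 * K))), by positivity, fun q hq => ?_, F, hF1, fun q hq =>
    ⟨hsub' (ball_subset_ball (min_le_left _ _) hq), hF q (ball_subset_ball (min_le_right _ _) hq)⟩⟩
  exact (hsub (hcb (ball_subset_closedBall (ball_subset_ball (min_le_right _ _) hq)))).1

/-- The quotient of two solutions of the same linear system has zero derivative. -/
theorem hasFDerivAt_inverse_mul {F H : ℝ × ℝ → 𝔸} {q : ℝ × ℝ} (hu : IsUnit (F q))
    (hF : HasPartialsAt F (A q * F q) (B q * F q) q)
    (hH : HasPartialsAt H (A q * H q) (B q * H q) q) :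
    HasFDerivAt (fun x => Ring.inverse (F x) * H x) (0 : ℝ × ℝ →L[ℝ] 𝔸) q := by
  obtain ⟨w, hw⟩ := hu
  have h1 : HasFDerivAt Ring.inverse (-ContinuousLinearMap.mulLeftRight ℝ 𝔸 ↑w⁻¹ ↑w⁻¹) (F q) := by
    rw [← hw]; exact hasFDerivAt_ringInverse w
  refine ((h1.comp q hF).mul' hH).congr_fderiv ?_
  ext <;> simp [← hw, mul_assoc]

end LocalFundamentalSolution

section Cocycle

theorem FiberBundleCore.exists_locallyConstant_section {ι X F : Type*} [TopologicalSpace X]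
    [SimplyConnectedSpace X] [LocallyPathConnectedSpace X] [TopologicalSpace F]
    [DiscreteTopology F] (Z : FiberBundleCore ι X F) (x₀ : X) (c₀ : F) :
    ∃ s : ι → X → F,
      (∀ i j x, x ∈ Z.baseSet i ∩ Z.baseSet j → Z.coordChange i j x (s i x) = s j x) ∧
      s (Z.indexAt x₀) x₀ = c₀ ∧
      ∀ i, ∀ x ∈ Z.baseSet i, ∀ᶠ y in 𝓝 x, s i y = s i x := by
  have cov : IsCoveringMap (Bundle.TotalSpace.proj : Z.TotalSpace → X) :=
    FiberBundle.isCoveringMap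
  obtain ⟨σ, ⟨hσ0, hσ⟩, -⟩ := cov.existsUnique_continuousMap_lifts (ContinuousMap.id X) x₀
    (⟨x₀, c₀⟩ : Z.TotalSpace) rfl
  have hproj : ∀ x, (σ x).1 = x := fun x => congrFun hσ x
  refine ⟨fun i x => (Z.localTriv i (σ x)).2, fun i j x hx => ?_, ?_, fun i x hx => ?_⟩
  · simp only [FiberBundleCore.localTriv_apply]
    rw [hproj x]
    exact Z.coordChange_comp _ _ _ _ ⟨⟨Z.mem_baseSet_at x, hx.1⟩, hx.2⟩ _
  · simp only [FiberBundleCore.localTriv_apply, hσ0]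
    exact Z.coordChange_self _ _ (Z.mem_baseSet_at x₀) _
  · have hsrc : σ x ∈ (Z.localTriv i).source := by
      rw [(Z.localTriv i).mem_source]
      change (σ x).1 ∈ Z.baseSet i
      rwa [hproj x]
    have hc : ContinuousAt (fun y => (Z.localTriv i (σ y)).2) x :=
      continuousAt_snd.comp (((Z.localTriv i).continuousAt hsrc).comp σ.continuous.continuousAt)
    have := hc.eventually (IsOpen.mem_nhds (isOpen_discrete {(Z.localTriv i (σ x)).2}) rfl)
    exact this

/-- A locally constant cocycle over a simply connected, locally path-connected space is trivial:
it admits a locally constant section through any prescribed value. -/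
theorem exists_section_of_locallyConstant_cocycle {ι X F : Type*} [TopologicalSpace X]
    [SimplyConnectedSpace X] [LocallyPathConnectedSpace X] (S : ι → Set X)
    (hS : ∀ i, IsOpen (S i)) (idx : X → ι) (hidx : ∀ x, x ∈ S (idx x)) (g : ι → ι → X → F → F)
    (hself : ∀ i, ∀ x ∈ S i, ∀ c, g i i x c = c)
    (hloc : ∀ i j, ∀ x ∈ S i ∩ S j, ∀ᶠ y in 𝓝 x, ∀ c, g i j y c = g i j x c)
    (hcomp : ∀ i j k, ∀ x ∈ S i ∩ S j ∩ S k, ∀ c, g j k x (g i j x c) = g i k x c)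
    (x₀ : X) (c₀ : F) :
    ∃ s : ι → X → F, (∀ i j x, x ∈ S i ∩ S j → g i j x (s i x) = s j x) ∧
      s (idx x₀) x₀ = c₀ ∧ ∀ i, ∀ x ∈ S i, ∀ᶠ y in 𝓝 x, s i y = s i x := by
  let : TopologicalSpace F := ⊥
  have : DiscreteTopology F := ⟨rfl⟩
  refine FiberBundleCore.exists_locallyConstant_section (X := X) (F := F)
    { baseSet := S
      isOpen_baseSet := hS
      indexAt := idx
      mem_baseSet_at := hidx
      coordChange := g
      coordChange_self := hself
      continuousOn_coordChange := ?_
      coordChange_comp := hcomp } x₀ c₀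
  rintro i j ⟨x, c⟩ ⟨hx, -⟩
  refine ContinuousAt.continuousWithinAt ?_
  have h1 : ContinuousAt (fun p : X × F => g i j x p.2) (x, c) :=
    (continuous_of_discreteTopology.comp continuous_snd).continuousAt
  refine h1.congr ?_
  filter_upwards [continuousAt_fst.eventually (hloc i j x hx)] with p hp
  exact (hp p.2).symm

end Cocycle

section GlobalExistence

theorem eventually_eq_of_eventually_hasFDerivAt_zero {V W : Type*} [NormedAddCommGroup V]
    [NormedSpace ℝ V] [NormedAddCommGroup W] [NormedSpace ℝ W] {f : V → W} {x : V}
    (h : ∀ᶠ y in 𝓝 x, HasFDerivAt f (0 : V →L[ℝ] W) y) : ∀ᶠ y in 𝓝 x, f y = f x := by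
  obtain ⟨s, hs, hsub⟩ := nhds_basis_ball.eventually_iff.1 h
  filter_upwards [ball_mem_nhds x hs] with y hy
  exact isOpen_ball.is_const_of_fderiv_eq_zero (𝕜 := ℝ) (convex_ball x s).isPreconnected
    (fun z hz => (hsub hz).differentiableAt.differentiableWithinAt)
    (fun z hz => (hsub hz).fderiv) hy (mem_ball_self hs)

variable {𝔸 : Type*} [NormedRing 𝔸] [NormedAlgebra ℝ 𝔸] {A B : ℝ × ℝ → 𝔸}

/-- A solution of a linear system with smooth coefficients is smooth. -/
theorem contDiffOn_of_hasPartialsAt_mul {U : Set (ℝ × ℝ)} (hU : IsOpen U)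
    (hA : ContDiffOn ℝ ∞ A U) (hB : ContDiffOn ℝ ∞ B U) {F : ℝ × ℝ → 𝔸}
    (hF : ∀ q ∈ U, HasPartialsAt F (A q * F q) (B q * F q) q) : ContDiffOn ℝ ∞ F U := by
  refine contDiffOn_infty.2 fun n => ?_
  induction n with
  | zero => exact contDiffOn_zero.2 fun q hq =>
      (hF q hq).differentiableAt.continuousAt.continuousWithinAt
  | succ n ih =>
    have hle : ((n : ℕ) : WithTop ℕ∞) ≤ ∞ := by exact_mod_cast le_top
    push_cast
    rw [contDiffOn_succ_iff_fderiv_of_isOpen hU]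
    refine ⟨fun q hq => (hF q hq).differentiableAt.differentiableWithinAt, by simp, ?_⟩
    refine ContDiffOn.congr ?_ (fun q hq => HasFDerivAt.fderiv (hF q hq))
    exact (contDiffOn_const.smulRight ((hA.of_le hle).mul ih)).add
      (contDiffOn_const.smulRight ((hB.of_le hle).mul ih))

variable [CompleteSpace 𝔸]

/-- A smooth linear system `F_u = A F`, `F_v = B F` with zero curvature on a simply connected open
set has a global solution with initial value `1`. -/
theorem exists_hasPartialsAt_mul {U : Set (ℝ × ℝ)} (hU : IsOpen U) (hsc : SimplyConnectedSpace U)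
    (hA : ContDiffOn ℝ ∞ A U) (hB : ContDiffOn ℝ ∞ B U)
    (hflat : ∀ q ∈ U, pv A q + A q * B q = pu B q + B q * A q) {p : ℝ × ℝ} (hp : p ∈ U) :
    ∃ F : ℝ × ℝ → 𝔸, F p = 1 ∧ ∀ q ∈ U, HasPartialsAt F (A q * F q) (B q * F q) q := by
  have : LocallyPathConnectedSpace U := hU.locallyPathConnectedSpace
  choose r hr hrU Φ hΦ1 hΦ using fun x : U => exists_isUnit_hasPartialsAt_mul hU hA hB hflat x.2
  obtain ⟨s, hs, hs0, hsloc⟩ := exists_section_of_locallyConstant_cocycle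
    (fun i : U => (Subtype.val ⁻¹' ball (i : ℝ × ℝ) (r i) : Set U))
    (fun i => isOpen_ball.preimage continuous_subtype_val) id
    (fun x => mem_ball_self (hr x))
    (fun i j x (c : 𝔸) => Ring.inverse (Φ j x) * Φ i x * c)
    (fun i x hx c => by rw [Ring.inverse_mul_cancel _ (hΦ i x hx).1, one_mul])
    (fun i j x hx => by
      have h0 : ∀ᶠ y in 𝓝 (x : ℝ × ℝ), HasFDerivAt (fun y => Ring.inverse (Φ j y) * Φ i y)
          (0 : ℝ × ℝ →L[ℝ] 𝔸) y := by
        filter_upwards [isOpen_ball.mem_nhds hx.1, isOpen_ball.mem_nhds hx.2] with y hi hj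
        exact hasFDerivAt_inverse_mul (hΦ j y hj).1 (hΦ j y hj).2 (hΦ i y hi).2
      filter_upwards [continuousAt_subtype_val.eventually
        (eventually_eq_of_eventually_hasFDerivAt_zero h0)] with y hy c
      rw [hy])
    (fun i j k x hx c => by
      have := Ring.mul_inverse_cancel _ (hΦ j x hx.1.2).1
      calc Ring.inverse (Φ k x) * Φ j x * (Ring.inverse (Φ j x) * Φ i x * c)
          = Ring.inverse (Φ k x) * (Φ j x * Ring.inverse (Φ j x)) * Φ i x * c := by
            simp only [mul_assoc]
        _ = _ := by rw [this, mul_one])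
    ⟨p, hp⟩ 1
  classical
  let F : ℝ × ℝ → 𝔸 := fun q => if hq : q ∈ U then Φ ⟨q, hq⟩ q * s ⟨q, hq⟩ ⟨q, hq⟩ else 0
  have hF : ∀ (i : U) (q : U), (q : ℝ × ℝ) ∈ ball (i : ℝ × ℝ) (r i) → F q = Φ i q * s i q := by
    intro i q hq
    have h1 := hs i q q ⟨hq, mem_ball_self (hr q)⟩
    have h2 := Ring.mul_inverse_cancel _ (hΦ q q (mem_ball_self (hr q))).1
    simp only [F, q.2, dite_true]
    rw [← h1, ← mul_assoc, ← mul_assoc, h2, one_mul]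
  refine ⟨F, ?_, fun q hq => ?_⟩
  · rw [hF ⟨p, hp⟩ ⟨p, hp⟩ (mem_ball_self (hr _))]
    erw [hs0]
    rw [hΦ1 ⟨p, hp⟩, one_mul]
  · let i : U := ⟨q, hq⟩
    have hqi : q ∈ ball (i : ℝ × ℝ) (r i) := mem_ball_self (hr i)
    have hloc : F =ᶠ[𝓝 q] fun y => Φ i y * s i i := by
      have h1 := hsloc i i hqi
      rw [nhds_subtype_eq_comap, Filter.eventually_comap] at h1
      filter_upwards [h1, isOpen_ball.mem_nhds hqi] with y hy hyi
      rw [hF i ⟨y, hrU i hyi⟩ hyi, hy ⟨y, hrU i hyi⟩ rfl]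
    have hd : HasPartialsAt (fun y => Φ i y * s i i) (A q * (Φ i q * s i i))
        (B q * (Φ i q * s i i)) q := by
      refine (HasFDerivAt.mul_const' (hΦ i q hqi).2 (s i i)).congr_fderiv ?_
      ext <;> simp [mul_assoc]
    have hFq : F q = Φ i q * s i i := hloc.eq_of_nhds
    rw [hFq]
    exact HasFDerivAt.congr_of_eventuallyEq hd hloc

end GlobalExistence

section PartialDerivativeCalculus

variable {V W : Type*} [NormedAddCommGroup V] [NormedSpace ℝ V] [NormedAddCommGroup W]
  [NormedSpace ℝ W] {q : ℝ × ℝ}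

theorem HasPartialsAt.clm_apply (L : V →L[ℝ] W) {F : ℝ × ℝ → V} {a b : V}
    (h : HasPartialsAt F a b q) : HasPartialsAt (fun x => L (F x)) (L a) (L b) q := by
  refine (L.hasFDerivAt.comp q h).congr_fderiv ?_
  ext <;> simp

theorem hasPartialsAt_pi {ι : Type*} [Fintype ι] {F : ℝ × ℝ → ι → V} {a b : ι → V} :
    HasPartialsAt F a b q ↔ ∀ i, HasPartialsAt (fun x => F x i) (a i) (b i) q := by
  unfold HasPartialsAt
  rw [hasFDerivAt_pi']
  refine forall_congr' fun i => ?_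
  have : (ContinuousLinearMap.proj i).comp ((ContinuousLinearMap.fst ℝ ℝ ℝ).smulRight a +
      (ContinuousLinearMap.snd ℝ ℝ ℝ).smulRight b) =
      (ContinuousLinearMap.fst ℝ ℝ ℝ).smulRight (a i) +
        (ContinuousLinearMap.snd ℝ ℝ ℝ).smulRight (b i) := by
    ext <;> simp
  rw [this]

theorem HasPartialsAt.congr {F F' : ℝ × ℝ → V} {a b a' b' : V} (h : HasPartialsAt F a b q)
    (hF : F' =ᶠ[𝓝 q] F) (ha : a' = a) (hb : b' = b) : HasPartialsAt F' a' b' q := by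
  subst ha hb
  exact HasFDerivAt.congr_of_eventuallyEq h hF

theorem hasPartialsAt_const (c : V) : HasPartialsAt (fun _ => c) 0 0 q :=
  (hasFDerivAt_const c q).congr_fderiv (by ext <;> simp)

theorem HasPartialsAt.add {F F' : ℝ × ℝ → V} {a b a' b' : V} (h : HasPartialsAt F a b q)
    (h' : HasPartialsAt F' a' b' q) :
    HasPartialsAt (fun x => F x + F' x) (a + a') (b + b') q := by
  refine (HasFDerivAt.add h h').congr_fderiv ?_
  ext <;> simp

theorem HasPartialsAt.neg {F : ℝ × ℝ → V} {a b : V} (h : HasPartialsAt F a b q) :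
    HasPartialsAt (fun x => -F x) (-a) (-b) q := by
  refine (HasFDerivAt.neg h).congr_fderiv ?_
  ext <;> simp

theorem HasPartialsAt.sub {F F' : ℝ × ℝ → V} {a b a' b' : V} (h : HasPartialsAt F a b q)
    (h' : HasPartialsAt F' a' b' q) :
    HasPartialsAt (fun x => F x - F' x) (a - a') (b - b') q := by
  simpa only [sub_eq_add_neg] using h.add h'.neg

variable {φ χ : ℝ × ℝ → ℝ} {a b a' b' : ℝ}

theorem HasPartialsAt.mul (h : HasPartialsAt φ a b q) (h' : HasPartialsAt χ a' b' q) :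
    HasPartialsAt (fun x => φ x * χ x) (a * χ q + φ q * a') (b * χ q + φ q * b') q := by
  refine (HasFDerivAt.mul h h').congr_fderiv ?_
  ext <;> simp <;> ring

theorem HasPartialsAt.inv (h : HasPartialsAt φ a b q) (h0 : φ q ≠ 0) :
    HasPartialsAt (fun x => (φ x)⁻¹) (-a / φ q ^ 2) (-b / φ q ^ 2) q := by
  refine ((hasDerivAt_inv h0).comp_hasFDerivAt q h).congr_fderiv ?_
  ext <;> simp <;> ring

theorem HasPartialsAt.div (h : HasPartialsAt φ a b q) (h' : HasPartialsAt χ a' b' q)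
    (h0 : χ q ≠ 0) :
    HasPartialsAt (fun x => φ x / χ x) ((a * χ q - φ q * a') / χ q ^ 2)
      ((b * χ q - φ q * b') / χ q ^ 2) q := by
  simp only [div_eq_mul_inv (φ _)]
  exact (h.mul (h'.inv h0)).congr .rfl (by field_simp; ring) (by field_simp; ring)

theorem HasPartialsAt.const_mul (c : ℝ) (h : HasPartialsAt φ a b q) :
    HasPartialsAt (fun x => c * φ x) (c * a) (c * b) q :=
  ((hasPartialsAt_const c).mul h).congr .rfl (by simp) (by simp)

theorem HasPartialsAt.div_const (c : ℝ) (h : HasPartialsAt φ a b q) :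
    HasPartialsAt (fun x => φ x / c) (a / c) (b / c) q := by
  simpa only [div_eq_inv_mul] using h.const_mul c⁻¹

variable {F : ℝ × ℝ → V} {U : Set (ℝ × ℝ)}

theorem ContDiffOn.hasPartialsAt (hU : IsOpen U) (hF : ContDiffOn ℝ ∞ F U) (hq : q ∈ U) :
    HasPartialsAt F (pu F q) (pv F q) q :=
  ((hF.contDiffAt (hU.mem_nhds hq)).differentiableAt (by simp)).hasPartialsAt

theorem ContDiffOn.pu (hU : IsOpen U) (hF : ContDiffOn ℝ ∞ F U) : ContDiffOn ℝ ∞ (pu F) U :=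
  (hF.fderiv_of_isOpen hU (m := ∞) (by simp)).clm_apply contDiffOn_const

theorem ContDiffOn.pv (hU : IsOpen U) (hF : ContDiffOn ℝ ∞ F U) : ContDiffOn ℝ ∞ (pv F) U :=
  (hF.fderiv_of_isOpen hU (m := ∞) (by simp)).clm_apply contDiffOn_const

theorem ContDiffOn.pv_pu_eq_pu_pv (hU : IsOpen U) (hF : ContDiffOn ℝ ∞ F U) (hq : q ∈ U) :
    _root_.pv (_root_.pu F) q = _root_.pu (_root_.pv F) q := by
  have hF' : ContDiffAt ℝ ∞ F q := hF.contDiffAt (hU.mem_nhds hq)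
  have hsymm := hF'.isSymmSndFDerivAt (by simpa using WithTop.coe_le_coe.2 (le_top : (2 : ℕ∞) ≤ ⊤))
  have hd : DifferentiableAt ℝ (fderiv ℝ F) q :=
    (hF'.fderiv_right (m := 1) (by norm_cast)).differentiableAt (by simp)
  have key : ∀ m n : ℝ × ℝ, fderiv ℝ (fun x => fderiv ℝ F x m) q n =
      fderiv ℝ (fderiv ℝ F) q n m := fun m n => by
    rw [fderiv_clm_apply hd (differentiableAt_const m)]
    simp
  exact (key _ _).trans ((hsymm.eq _ _).trans (key _ _).symm)

end PartialDerivativeCalculus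

section FrameSystem

/-- The first coefficient matrix of the linear system satisfied by `(f, f_u, f_v, ψ)`. -/
def frameMatrixU (E G X Y : ℝ × ℝ → ℝ) (q : ℝ × ℝ) : Fin 4 → Fin 4 → ℝ :=
  ![![0, 1, 0, 0],
    ![0, pu E q / (2 * E q), X q, -pv E q / 2 - X q * G q],
    ![0, pv E q / (2 * E q), Y q, pu G q / 2 - Y q * G q],
    ![0, -X q / E q, 0, -Y q]]

/-- The second coefficient matrix of the linear system satisfied by `(f, f_u, f_v, ψ)`. -/
def frameMatrixV (E G Y Z : ℝ × ℝ → ℝ) (q : ℝ × ℝ) : Fin 4 → Fin 4 → ℝ :=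
  ![![0, 0, 1, 0],
    ![0, pv E q / (2 * E q), Y q, pu G q / 2 - Y q * G q],
    ![0, -pu G q / (2 * E q), Z q, pv G q / 2 - Z q * G q],
    ![0, -Y q / E q, 0, -Z q]]

variable {E G X Y Z : ℝ × ℝ → ℝ} {U : Set (ℝ × ℝ)}

theorem contDiffOn_frameMatrixU (hU : IsOpen U) (hE : ContDiffOn ℝ ∞ E U)
    (hG : ContDiffOn ℝ ∞ G U) (hX : ContDiffOn ℝ ∞ X U) (hY : ContDiffOn ℝ ∞ Y U)
    (hE0 : ∀ q ∈ U, E q ≠ 0) : ContDiffOn ℝ ∞ (frameMatrixU E G X Y) U := by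
  have hEu := hE.pu hU
  have hEv := hE.pv hU
  have hGu := hG.pu hU
  have hE2 : ∀ q ∈ U, 2 * E q ≠ 0 := fun q hq => mul_ne_zero two_ne_zero (hE0 q hq)
  have hE' : ContDiffOn ℝ ∞ (fun q => 2 * E q) U := contDiffOn_const.mul hE
  refine contDiffOn_pi.2 fun i => contDiffOn_pi.2 fun j => ?_
  fin_cases i <;> fin_cases j <;> simp only [frameMatrixU] <;> first
    | exact contDiffOn_const
    | exact hX
    | exact hY
    | exact hY.neg
    | exact hEu.div hE' hE2
    | exact hEv.div hE' hE2
    | exact hX.neg.div hE hE0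
    | exact (hEv.neg.div_const 2).sub (hX.mul hG)
    | exact (hGu.div_const 2).sub (hY.mul hG)

theorem contDiffOn_frameMatrixV (hU : IsOpen U) (hE : ContDiffOn ℝ ∞ E U)
    (hG : ContDiffOn ℝ ∞ G U) (hY : ContDiffOn ℝ ∞ Y U) (hZ : ContDiffOn ℝ ∞ Z U)
    (hE0 : ∀ q ∈ U, E q ≠ 0) : ContDiffOn ℝ ∞ (frameMatrixV E G Y Z) U := by
  have hEv := hE.pv hU
  have hGu := hG.pu hU
  have hGv := hG.pv hU
  have hE2 : ∀ q ∈ U, 2 * E q ≠ 0 := fun q hq => mul_ne_zero two_ne_zero (hE0 q hq)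
  have hE' : ContDiffOn ℝ ∞ (fun q => 2 * E q) U := contDiffOn_const.mul hE
  refine contDiffOn_pi.2 fun i => contDiffOn_pi.2 fun j => ?_
  fin_cases i <;> fin_cases j <;> simp only [frameMatrixV] <;> first
    | exact contDiffOn_const
    | exact hY
    | exact hZ
    | exact hZ.neg
    | exact hEv.div hE' hE2
    | exact hGu.neg.div hE' hE2
    | exact hY.neg.div hE hE0
    | exact (hGu.div_const 2).sub (hY.mul hG)
    | exact (hGv.div_const 2).sub (hZ.mul hG)

theorem frameMatrix_flat (hU : IsOpen U) (hE : ContDiffOn ℝ ∞ E U)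
    (hG : ContDiffOn ℝ ∞ G U) (hX : ContDiffOn ℝ ∞ X U) (hY : ContDiffOn ℝ ∞ Y U)
    (hZ : ContDiffOn ℝ ∞ Z U) (hE0 : ∀ q ∈ U, E q ≠ 0)
    (hC1 : ∀ q ∈ U, pv X q - pu Y q
      = (pv E q * X q - pu E q * Y q) / (2 * E q) + (Y q) ^ 2 - X q * Z q)
    (hC2 : ∀ q ∈ U, pv Y q - pu Z q
      = -((pu G q * X q + pv E q * Y q) / (2 * E q)))
    (hGauss : ∀ q ∈ U, pv (pv E) q + pu (pu G) q
        - (pu E q * pu G q + (pv E q) ^ 2) / (2 * E q)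
      = 2 * G q * (X q * Z q - (Y q) ^ 2)
        - pv G q * X q + 2 * pu G q * Y q + pv E q * Z q) {q : ℝ × ℝ} (hq : q ∈ U)
    (i j : Fin 4) :
    pv (fun x => frameMatrixU E G X Y x i j) q +
        ∑ k, frameMatrixU E G X Y q i k * frameMatrixV E G Y Z q k j =
      pu (fun x => frameMatrixV E G Y Z x i j) q +
        ∑ k, frameMatrixV E G Y Z q i k * frameMatrixU E G X Y q k j := by
  have hE0 := hE0 q hq
  have hC1 := hC1 q hq
  have hC2 := hC2 q hq
  have hGauss := hGauss q hq
  have h2E : (fun x => 2 * E x) q ≠ 0 := mul_ne_zero two_ne_zero hE0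
  have dE := hE.hasPartialsAt hU hq
  have dG := hG.hasPartialsAt hU hq
  have dX := hX.hasPartialsAt hU hq
  have dY := hY.hasPartialsAt hU hq
  have dZ := hZ.hasPartialsAt hU hq
  have dEu := (hE.pu hU).hasPartialsAt hU hq
  have dEv := (hE.pv hU).hasPartialsAt hU hq
  have dGu := (hG.pu hU).hasPartialsAt hU hq
  have dGv := (hG.pv hU).hasPartialsAt hU hq
  have sE := hE.pv_pu_eq_pu_pv hU hq
  have sG := hG.pv_pu_eq_pu_pv hU hq
  have d2E := dE.const_mul 2
  have a₁ := (dEu.div d2E h2E).pv_eq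
  have a₂ := ((dEv.neg.div_const 2).sub (dX.mul dG)).pv_eq
  have a₃ := (dEv.div d2E h2E).pv_eq
  have a₄ := ((dGu.div_const 2).sub (dY.mul dG)).pv_eq
  have a₅ := (dX.neg.div dE hE0).pv_eq
  have a₆ := dY.neg.pv_eq
  have b₁ := (dEv.div d2E h2E).pu_eq
  have b₂ := ((dGu.div_const 2).sub (dY.mul dG)).pu_eq
  have b₃ := (dGu.neg.div d2E h2E).pu_eq
  have b₄ := ((dGv.div_const 2).sub (dZ.mul dG)).pu_eq
  have b₅ := (dY.neg.div dE hE0).pu_eq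
  have b₆ := dZ.neg.pu_eq
  have u0 : ∀ c : ℝ, pu (fun _ : ℝ × ℝ => c) q = 0 := fun c => (hasPartialsAt_const c).pu_eq
  have v0 : ∀ c : ℝ, pv (fun _ : ℝ × ℝ => c) q = 0 := fun c => (hasPartialsAt_const c).pv_eq
  have xv : pv X q = pu Y q +
      ((pv E q * X q - pu E q * Y q) / (2 * E q) + (Y q) ^ 2 - X q * Z q) := by linarith
  have yv : pv Y q = pu Z q - (pu G q * X q + pv E q * Y q) / (2 * E q) := by linarith
  have guu : pu (pu G) q = 2 * G q * (X q * Z q - (Y q) ^ 2) - pv G q * X q + 2 * pu G q * Y q +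
      pv E q * Z q - pv (pv E) q + (pu E q * pu G q + (pv E q) ^ 2) / (2 * E q) := by linarith
  fin_cases i <;> fin_cases j <;>
    simp [frameMatrixU, frameMatrixV, Fin.sum_univ_four, a₁, a₂, a₃, a₄, a₅, a₆, b₁, b₂, b₃, b₄,
      b₅, b₆, u0, v0] <;>
    (try simp only [sE, sG, xv, yv, guu]) <;> field_simp <;> ring

end FrameSystem

section FrameForm

/-- `(p, r, s)` is differentiable at `q` and satisfies there the linear system governing any
single coordinate of `(f_u, f_v, ψ)`. -/
structure IsFrameCoordAt (E G X Y Z p r s : ℝ × ℝ → ℝ) (q : ℝ × ℝ) : Prop where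
  fst : HasPartialsAt p
    (pu E q / (2 * E q) * p q + X q * r q + (-pv E q / 2 - X q * G q) * s q)
    (pv E q / (2 * E q) * p q + Y q * r q + (pu G q / 2 - Y q * G q) * s q) q
  snd : HasPartialsAt r
    (pv E q / (2 * E q) * p q + Y q * r q + (pu G q / 2 - Y q * G q) * s q)
    (-pu G q / (2 * E q) * p q + Z q * r q + (pv G q / 2 - Z q * G q) * s q) q
  normal : HasPartialsAt s (-X q / E q * p q - Y q * s q) (-Y q / E q * p q - Z q * s q) q

theorem exists_isFrameCoordAt {E G X Y Z : ℝ × ℝ → ℝ} {U : Set (ℝ × ℝ)} (hU : IsOpen U)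
    (hsc : SimplyConnectedSpace U) (hE : ContDiffOn ℝ ∞ E U) (hG : ContDiffOn ℝ ∞ G U)
    (hX : ContDiffOn ℝ ∞ X U) (hY : ContDiffOn ℝ ∞ Y U) (hZ : ContDiffOn ℝ ∞ Z U)
    (hE0 : ∀ q ∈ U, E q ≠ 0)
    (hC1 : ∀ q ∈ U, pv X q - pu Y q
      = (pv E q * X q - pu E q * Y q) / (2 * E q) + (Y q) ^ 2 - X q * Z q)
    (hC2 : ∀ q ∈ U, pv Y q - pu Z q
      = -((pu G q * X q + pv E q * Y q) / (2 * E q)))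
    (hGauss : ∀ q ∈ U, pv (pv E) q + pu (pu G) q
        - (pu E q * pu G q + (pv E q) ^ 2) / (2 * E q)
      = 2 * G q * (X q * Z q - (Y q) ^ 2)
        - pv G q * X q + 2 * pu G q * Y q + pv E q * Z q)
    {x₀ : ℝ × ℝ} (hx₀ : x₀ ∈ U) (c : Fin 4 → ℝ) :
    ∃ f p r s : ℝ × ℝ → ℝ, ContDiffOn ℝ ∞ f U ∧ ContDiffOn ℝ ∞ s U ∧
      (∀ q ∈ U, HasPartialsAt f (p q) (r q) q ∧ IsFrameCoordAt E G X Y Z p r s q) ∧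
      f x₀ = c 0 ∧ p x₀ = c 1 ∧ r x₀ = c 2 ∧ s x₀ = c 3 := by
  let L : (Fin 4 → Fin 4 → ℝ) →L[ℝ] ((Fin 4 → ℝ) →L[ℝ] (Fin 4 → ℝ)) :=
    LinearMap.toContinuousLinearMap
      ((LinearMap.toContinuousLinearMap : ((Fin 4 → ℝ) →ₗ[ℝ] (Fin 4 → ℝ)) ≃ₗ[ℝ] _).toLinearMap ∘ₗ
        (Matrix.toLin' : Matrix (Fin 4) (Fin 4) ℝ ≃ₗ[ℝ] _).toLinearMap)
  have hL : ∀ M y i, L M y i = ∑ j, M i j * y j := fun M y i => rfl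
  have ha := contDiffOn_frameMatrixU hU hE hG hX hY hE0
  have hb := contDiffOn_frameMatrixV hU hE hG hY hZ hE0
  have hA : ContDiffOn ℝ ∞ (fun q => L (frameMatrixU E G X Y q)) U :=
    L.contDiff.comp_contDiffOn ha
  have hB : ContDiffOn ℝ ∞ (fun q => L (frameMatrixV E G Y Z q)) U :=
    L.contDiff.comp_contDiffOn hb
  obtain ⟨F, hF0, hF⟩ := exists_hasPartialsAt_mul hU hsc hA hB (fun q hq => by
    have hda := ha.hasPartialsAt hU hq
    have hdb := hb.hasPartialsAt hU hq
    rw [(hda.clm_apply L).pv_eq, (hdb.clm_apply L).pu_eq]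
    ext y i
    have key : ∀ j, pv (frameMatrixU E G X Y) q i j +
          ∑ k, frameMatrixU E G X Y q i k * frameMatrixV E G Y Z q k j =
        pu (frameMatrixV E G Y Z) q i j +
          ∑ k, frameMatrixV E G Y Z q i k * frameMatrixU E G X Y q k j := fun j => by
      have h := frameMatrix_flat hU hE hG hX hY hZ hE0 hC1 hC2 hGauss hq i j
      rwa [(hasPartialsAt_pi.1 (hasPartialsAt_pi.1 hda i) j).pv_eq,
        (hasPartialsAt_pi.1 (hasPartialsAt_pi.1 hdb i) j).pu_eq] at h
    have hsum : ∀ M N : Fin 4 → Fin 4 → ℝ,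
        L M (L N y) i = ∑ j, (∑ k, M i k * N k j) * y j := fun M N => by
      simp only [hL, Finset.mul_sum, Finset.sum_mul, ← mul_assoc]
      exact Finset.sum_comm
    simp only [add_apply, mul_apply_eq_comp, Pi.add_apply, hsum]
    simp only [hL, ← Finset.sum_add_distrib, ← add_mul, key]) hx₀
  have hFs := contDiffOn_of_hasPartialsAt_mul hU hA hB hF
  have hy : ContDiffOn ℝ ∞ (fun q => F q c) U := hFs.clm_apply contDiffOn_const
  have hyi := contDiffOn_pi.1 hy
  have hdy : ∀ q ∈ U, ∀ i, HasPartialsAt (fun x => F x c i)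
      (∑ j, frameMatrixU E G X Y q i j * F q c j)
      (∑ j, frameMatrixV E G Y Z q i j * F q c j) q := fun q hq =>
    hasPartialsAt_pi.1 ((hF q hq).clm_apply
      (ContinuousLinearMap.apply ℝ (Fin 4 → ℝ) c))
  have hinit : ∀ i, F x₀ c i = c i := fun i => by rw [hF0]; rfl
  refine ⟨fun q => F q c 0, fun q => F q c 1, fun q => F q c 2, fun q => F q c 3, hyi 0, hyi 3,
    fun q hq => ⟨(hdy q hq 0).congr .rfl ?_ ?_, (hdy q hq 1).congr .rfl ?_ ?_,
      (hdy q hq 2).congr .rfl ?_ ?_, (hdy q hq 3).congr .rfl ?_ ?_⟩,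
    hinit 0, hinit 1, hinit 2, hinit 3⟩ <;>
  simp [frameMatrixU, frameMatrixV, Fin.sum_univ_four] <;> ring

/-- The bilinear expression in two frame coordinates that is constant along solutions; its
coefficients form the inverse of the Gram matrix of a frame. -/
def frameForm (E G p r s p' r' s' : ℝ) : ℝ :=
  p * p' / E + r * s' + s * r' - G * (s * s')

theorem IsFrameCoordAt.hasPartialsAt_frameForm {E G X Y Z p r s p' r' s' : ℝ × ℝ → ℝ}
    {q : ℝ × ℝ} (h : IsFrameCoordAt E G X Y Z p r s q)
    (h' : IsFrameCoordAt E G X Y Z p' r' s' q) (hE : DifferentiableAt ℝ E q)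
    (hG : DifferentiableAt ℝ G q) (hE0 : E q ≠ 0) :
    HasPartialsAt (fun x => frameForm (E x) (G x) (p x) (r x) (s x) (p' x) (r' x) (s' x))
      0 0 q := by
  refine (((((h.fst.mul h'.fst).div hE.hasPartialsAt hE0).add (h.snd.mul h'.normal)).add
    (h.normal.mul h'.snd)).sub (hG.hasPartialsAt.mul (h.normal.mul h'.normal))).congr .rfl ?_ ?_
  all_goals field_simp; ring

end FrameForm

section MovingFrames

/-- The Gram conditions for a frame of a lightlike-normalised surface: `P, Q` play the role of
the coordinate tangent vectors and `S` that of the transversal null vector. -/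
structure HasFrameGram (E G : ℝ) (P Q S : Fin 3 → ℝ) : Prop where
  fst_fst : mink P P = E
  fst_snd : mink P Q = 0
  snd_snd : mink Q Q = G
  normal_normal : mink S S = 0
  normal_fst : mink S P = 0
  normal_snd : mink S Q = 1

open Matrix in
theorem hasFrameGram_iff_frameForm {E G : ℝ} {P Q S : Fin 3 → ℝ} (hE : E ≠ 0) :
    HasFrameGram E G P Q S ↔ ∀ k l, frameForm E G (P k) (Q k) (S k) (P l) (Q l) (S l) =
      diagonal (![1, 1, -1] : Fin 3 → ℝ) k l := by
  let M : Matrix (Fin 3) (Fin 3) ℝ := of fun k => ![P k, Q k, S k]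
  let N : Matrix (Fin 3) (Fin 3) ℝ :=
    of fun c l => (![1, 1, -1] : Fin 3 → ℝ) l * ![P l / E, S l, Q l - G * S l] c
  have h1 : N * M = 1 ↔ HasFrameGram E G P Q S := by
    constructor
    · intro h
      have e := fun c d => congrFun (congrFun h c) d
      have e00 := e 0 0
      have e01 := e 0 1
      have e10 := e 1 0
      have e11 := e 1 1
      have e12 := e 1 2
      have e21 := e 2 1
      simp [Matrix.mul_apply, Fin.sum_univ_three, M, N] at e00 e01 e10 e11 e12 e21
      field_simp at e00 e01
      constructor <;> unfold mink <;>
        first | linarith | linear_combination e21 + G * e11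
    · rintro ⟨h1, h2, h3, h4, h5, h6⟩
      unfold mink at h1 h2 h3 h4 h5 h6
      ext c d
      fin_cases c <;> fin_cases d <;>
        simp [Matrix.mul_apply, Fin.sum_univ_three, M, N] <;>
        first
          | linarith
          | linear_combination h2 - G * h5
          | linear_combination h3 - G * h6
          | linear_combination h6 - G * h4
          | (field_simp; linarith)
  rw [← h1, mul_eq_one_comm, ← Matrix.ext_iff]
  refine forall_congr' fun k => forall_congr' fun l => ?_
  have h2 : (M * N) k l = (![1, 1, -1] : Fin 3 → ℝ) l *
      frameForm E G (P k) (Q k) (S k) (P l) (Q l) (S l) := by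
    simp [Matrix.mul_apply, Fin.sum_univ_three, M, N, frameForm]
    ring
  rw [h2]
  fin_cases k <;> fin_cases l <;> simp [neg_eq_iff_eq_neg]

theorem eq_frame_sum_of_frameForm {E G : ℝ} {P Q S P' Q' S' : Fin 3 → ℝ}
    (hT : ∀ k l, frameForm E G (P' k) (Q' k) (S' k) (P l) (Q l) (S l) =
      Matrix.diagonal (![1, 1, -1] : Fin 3 → ℝ) k l) (x : Fin 3 → ℝ) (k : Fin 3) :
    x k = mink x P / E * P' k + mink x S * Q' k + (mink x Q - mink x S * G) * S' k := by
  have h0 := hT k 0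
  have h1 := hT k 1
  have h2 := hT k 2
  unfold frameForm at h0 h1 h2
  unfold mink
  have : x k = x 0 * Matrix.diagonal (![1, 1, -1] : Fin 3 → ℝ) k 0 +
      x 1 * Matrix.diagonal (![1, 1, -1] : Fin 3 → ℝ) k 1 -
      x 2 * Matrix.diagonal (![1, 1, -1] : Fin 3 → ℝ) k 2 := by
    fin_cases k <;> simp
  rw [this, ← h0, ← h1, ← h2]
  ring

theorem mink_comm (x y : Fin 3 → ℝ) : mink x y = mink y x := by
  unfold mink
  ring

theorem HasFrameGram.eq_of_frameForm {E G : ℝ} {P Q S P' Q' S' : Fin 3 → ℝ}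
    (h : HasFrameGram E G P Q S) (hE : E ≠ 0)
    (hT : ∀ k l, frameForm E G (P' k) (Q' k) (S' k) (P l) (Q l) (S l) =
      Matrix.diagonal (![1, 1, -1] : Fin 3 → ℝ) k l) : P' = P ∧ Q' = Q ∧ S' = S := by
  obtain ⟨g1, g2, g3, g4, g5, g6⟩ := h
  have key := eq_frame_sum_of_frameForm hT
  refine ⟨funext fun k => ?_, funext fun k => ?_, funext fun k => ?_⟩
  · rw [key P k, g1, mink_comm P S, g5, g2]; field_simp; ring
  · rw [key Q k, mink_comm Q P, g2, mink_comm Q S, g6, g3]; ring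
  · rw [key S k, g4, g5, g6]; ring

theorem HasPartialsAt.mink {F F' : ℝ × ℝ → Fin 3 → ℝ} {a b a' b' : Fin 3 → ℝ} {q : ℝ × ℝ}
    (h : HasPartialsAt F a b q) (h' : HasPartialsAt F' a' b' q) :
    HasPartialsAt (fun x => mink (F x) (F' x)) (mink a (F' q) + mink (F q) a')
      (mink b (F' q) + mink (F q) b') q := by
  have H := hasPartialsAt_pi.1 h
  have H' := hasPartialsAt_pi.1 h'
  refine ((((H 0).mul (H' 0)).add ((H 1).mul (H' 1))).sub ((H 2).mul (H' 2))).congr .rfl ?_ ?_ <;>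
  · unfold _root_.mink
    ring

variable {E G X Y Z : ℝ × ℝ → ℝ} {U : Set (ℝ × ℝ)}

/-- The coordinates of an adapted frame satisfy the linear frame system. -/
theorem isFrameCoordAt_of_hasFrameGram (hU : IsOpen U) (hE : ContDiffOn ℝ ∞ E U)
    (hG : ContDiffOn ℝ ∞ G U) (hE0 : ∀ q ∈ U, E q ≠ 0) {f ψ : ℝ × ℝ → Fin 3 → ℝ}
    (hf : ContDiffOn ℝ ∞ f U) (hψ : ContDiffOn ℝ ∞ ψ U)
    (hgram : ∀ q ∈ U, HasFrameGram (E q) (G q) (pu f q) (pv f q) (ψ q))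
    {q : ℝ × ℝ} (hq : q ∈ U) (hX : mink (pu (pu f) q) (ψ q) = X q)
    (hY : mink (pv (pu f) q) (ψ q) = Y q) (hZ : mink (pv (pv f) q) (ψ q) = Z q) (k : Fin 3) :
    IsFrameCoordAt E G X Y Z (fun x => pu f x k) (fun x => pv f x k) (fun x => ψ x k) q := by
  have hPQ := hf.pv_pu_eq_pu_pv hU hq
  have dP := (hf.pu hU).hasPartialsAt hU hq
  have dQ := (hf.pv hU).hasPartialsAt hU hq
  have dS := hψ.hasPartialsAt hU hq
  rw [← hPQ] at dQ
  have dE := hE.hasPartialsAt hU hq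
  have dG := hG.hasPartialsAt hU hq
  have hev : ∀ᶠ x in 𝓝 q, HasFrameGram (E x) (G x) (pu f x) (pv f x) (ψ x) :=
    Filter.eventually_of_mem (hU.mem_nhds hq) hgram
  have e1 := dE.congr (hev.mono fun x h => h.fst_fst) rfl rfl
  have e2 := (hasPartialsAt_const (0 : ℝ)).congr (hev.mono fun x h => h.fst_snd) rfl rfl
  have e3 := dG.congr (hev.mono fun x h => h.snd_snd) rfl rfl
  have e4 := (hasPartialsAt_const (0 : ℝ)).congr (hev.mono fun x h => h.normal_normal) rfl rfl
  have e5 := (hasPartialsAt_const (0 : ℝ)).congr (hev.mono fun x h => h.normal_fst) rfl rfl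
  have e6 := (hasPartialsAt_const (1 : ℝ)).congr (hev.mono fun x h => h.normal_snd) rfl rfl
  have u1 := (dP.mink dP).pu_eq.symm.trans e1.pu_eq
  have u2 := (dP.mink dQ).pu_eq.symm.trans e2.pu_eq
  have u3 := (dQ.mink dQ).pu_eq.symm.trans e3.pu_eq
  have u4 := (dS.mink dS).pu_eq.symm.trans e4.pu_eq
  have u5 := (dS.mink dP).pu_eq.symm.trans e5.pu_eq
  have u6 := (dS.mink dQ).pu_eq.symm.trans e6.pu_eq
  have v1 := (dP.mink dP).pv_eq.symm.trans e1.pv_eq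
  have v2 := (dP.mink dQ).pv_eq.symm.trans e2.pv_eq
  have v3 := (dQ.mink dQ).pv_eq.symm.trans e3.pv_eq
  have v4 := (dS.mink dS).pv_eq.symm.trans e4.pv_eq
  have v5 := (dS.mink dP).pv_eq.symm.trans e5.pv_eq
  have v6 := (dS.mink dQ).pv_eq.symm.trans e6.pv_eq
  rw [mink_comm (pu f q)] at u1 u2 v1 v2
  rw [mink_comm (pv f q)] at u3 v3
  rw [mink_comm (ψ q)] at u4 u5 u6 v4 v5 v6
  rw [hX] at u5
  rw [hY] at u6 v5
  rw [hZ] at v6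
  have key := eq_frame_sum_of_frameForm ((hasFrameGram_iff_frameForm (hE0 q hq)).1 (hgram q hq))
  have hPk := hasPartialsAt_pi.1 dP k
  have hQk := hasPartialsAt_pi.1 dQ k
  have hSk := hasPartialsAt_pi.1 dS k
  have hUU : pu (pu f) q k = pu E q / (2 * E q) * pu f q k + X q * pv f q k +
      (-pv E q / 2 - X q * G q) * ψ q k := by
    rw [key (pu (pu f) q) k, hX, show mink (pu (pu f) q) (pu f q) = pu E q / 2 by linarith,
      show mink (pu (pu f) q) (pv f q) = -pv E q / 2 by linarith]
    field_simp
  have hUV : pv (pu f) q k = pv E q / (2 * E q) * pu f q k + Y q * pv f q k +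
      (pu G q / 2 - Y q * G q) * ψ q k := by
    rw [key (pv (pu f) q) k, hY, show mink (pv (pu f) q) (pu f q) = pv E q / 2 by linarith,
      show mink (pv (pu f) q) (pv f q) = pu G q / 2 by linarith]
    field_simp
  have hVV : pv (pv f) q k = -pu G q / (2 * E q) * pu f q k + Z q * pv f q k +
      (pv G q / 2 - Z q * G q) * ψ q k := by
    rw [key (pv (pv f) q) k, hZ, show mink (pv (pv f) q) (pu f q) = -pu G q / 2 by linarith,
      show mink (pv (pv f) q) (pv f q) = pv G q / 2 by linarith]
    field_simp
  have hSU : pu ψ q k = -X q / E q * pu f q k - Y q * ψ q k := by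
    rw [key (pu ψ q) k, show mink (pu ψ q) (pu f q) = -X q by linarith,
      show mink (pu ψ q) (pv f q) = -Y q by linarith, show mink (pu ψ q) (ψ q) = 0 by linarith]
    ring
  have hSV : pv ψ q k = -Y q / E q * pu f q k - Z q * ψ q k := by
    rw [key (pv ψ q) k, show mink (pv ψ q) (pu f q) = -Y q by linarith,
      show mink (pv ψ q) (pv f q) = -Z q by linarith, show mink (pv ψ q) (ψ q) = 0 by linarith]
    ring
  exact ⟨hPk.congr .rfl hUU.symm hUV.symm, hQk.congr .rfl hUV.symm hVV.symm,
    hSk.congr .rfl hSU.symm hSV.symm⟩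

theorem eq_of_hasPartialsAt_zero (hU : IsOpen U) (hconn : IsPreconnected U) {V : Type*}
    [NormedAddCommGroup V] [NormedSpace ℝ V] {F : ℝ × ℝ → V}
    (hF : ∀ q ∈ U, HasPartialsAt F 0 0 q) {x y : ℝ × ℝ} (hx : x ∈ U) (hy : y ∈ U) :
    F x = F y := by
  refine hU.is_const_of_fderiv_eq_zero (𝕜 := ℝ) hconn
    (fun z hz => (hF z hz).differentiableAt.differentiableWithinAt) (fun z hz => ?_) hx hy
  rw [HasFDerivAt.fderiv (hF z hz)]
  ext <;> simp

/-- If two frames solve the frame system and are initially equal to the same adapted frame, then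
their `frameForm` is everywhere the Minkowski metric. -/
theorem frameForm_eq_of_isFrameCoordAt (hU : IsOpen U) (hconn : IsPreconnected U)
    (hE : ContDiffOn ℝ ∞ E U) (hG : ContDiffOn ℝ ∞ G U) (hE0 : ∀ q ∈ U, E q ≠ 0)
    {P Q S P' Q' S' : ℝ × ℝ → Fin 3 → ℝ}
    (h : ∀ q ∈ U, ∀ k, IsFrameCoordAt E G X Y Z (fun x => P x k) (fun x => Q x k)
      (fun x => S x k) q)
    (h' : ∀ q ∈ U, ∀ k, IsFrameCoordAt E G X Y Z (fun x => P' x k) (fun x => Q' x k)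
      (fun x => S' x k) q) {x₀ : ℝ × ℝ} (hx₀ : x₀ ∈ U)
    (hP : P' x₀ = P x₀) (hQ : Q' x₀ = Q x₀) (hS : S' x₀ = S x₀)
    (hgram : HasFrameGram (E x₀) (G x₀) (P x₀) (Q x₀) (S x₀)) {q : ℝ × ℝ} (hq : q ∈ U)
    (k l : Fin 3) :
    frameForm (E q) (G q) (P' q k) (Q' q k) (S' q k) (P q l) (Q q l) (S q l) =
      Matrix.diagonal (![1, 1, -1] : Fin 3 → ℝ) k l := by
  have hc := eq_of_hasPartialsAt_zero hU hconn (fun x hx =>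
    (h' x hx k).hasPartialsAt_frameForm (h x hx l) (hE.hasPartialsAt hU hx).differentiableAt
      (hG.hasPartialsAt hU hx).differentiableAt (hE0 x hx)) hq hx₀
  refine hc.trans ?_
  rw [hP, hQ, hS]
  exact (hasFrameGram_iff_frameForm (hE0 x₀ hx₀)).1 hgram k l

end MovingFrames

end FrameTheory

/-- Fundamental theorem with initial conditions. Given smooth data
`E > 0` (`E(0,0) = 1`), `G` (`G(0,0) = 0`, `dG(0,0) ≠ 0`) and `X, Y, Z` on a
connected, simply connected open neighborhood `U` of `(0,0)` satisfying the
Gauss–Codazzi equations, and a null basis `w₁, w₂, w₃` of `𝕃³`, there is a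
unique pair `(f, ψ)` of smooth maps realizing the data with `f(0,0) = 0`,
`f_u(0,0) = w₁`, `f_v(0,0) = w₂`, `ψ(0,0) = w₃`. -/
theorem fundamental_theorem_with_initial_conditions
    (U : Set (ℝ × ℝ)) (hU : IsOpen U) (h00 : (0, 0) ∈ U)
    (hconn : IsConnected U) (hsc : SimplyConnectedSpace U)
    (E G X Y Z : ℝ × ℝ → ℝ)
    (hE : ContDiffOn ℝ (⊤ : ℕ∞) E U)
    (hG : ContDiffOn ℝ (⊤ : ℕ∞) G U)
    (hX : ContDiffOn ℝ (⊤ : ℕ∞) X U)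
    (hY : ContDiffOn ℝ (⊤ : ℕ∞) Y U)
    (hZ : ContDiffOn ℝ (⊤ : ℕ∞) Z U)
    (hEpos : ∀ q ∈ U, 0 < E q)
    (hE1 : E (0, 0) = 1)
    (hG0 : G (0, 0) = 0) (hdG : fderiv ℝ G (0, 0) ≠ 0)
    (hC1 : ∀ q ∈ U, pv X q - pu Y q
      = (pv E q * X q - pu E q * Y q) / (2 * E q) + (Y q) ^ 2 - X q * Z q)
    (hC2 : ∀ q ∈ U, pv Y q - pu Z q
      = -((pu G q * X q + pv E q * Y q) / (2 * E q)))
    (hGauss : ∀ q ∈ U, pv (pv E) q + pu (pu G) q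
        - (pu E q * pu G q + (pv E q) ^ 2) / (2 * E q)
      = 2 * G q * (X q * Z q - (Y q) ^ 2)
        - pv G q * X q + 2 * pu G q * Y q + pv E q * Z q)
    (w₁ w₂ w₃ : Fin 3 → ℝ)
    (hw11 : mink w₁ w₁ = 1) (hw23 : mink w₂ w₃ = 1)
    (hw12 : mink w₁ w₂ = 0) (hw13 : mink w₁ w₃ = 0)
    (hw22 : mink w₂ w₂ = 0) (hw33 : mink w₃ w₃ = 0) :
    ∃ (f ψ : ℝ × ℝ → Fin 3 → ℝ),
      (ContDiffOn ℝ (⊤ : ℕ∞) f U ∧ ContDiffOn ℝ (⊤ : ℕ∞) ψ U ∧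
        (∀ q ∈ U,
          mink (pu f q) (pu f q) = E q ∧ mink (pu f q) (pv f q) = 0 ∧
          mink (pv f q) (pv f q) = G q ∧ mink (ψ q) (ψ q) = 0 ∧
          mink (ψ q) (pu f q) = 0 ∧ mink (ψ q) (pv f q) = 1 ∧
          mink (pu (pu f) q) (ψ q) = X q ∧ mink (pv (pu f) q) (ψ q) = Y q ∧
          mink (pv (pv f) q) (ψ q) = Z q) ∧
        f (0, 0) = 0 ∧
        pu f (0, 0) = w₁ ∧ pv f (0, 0) = w₂ ∧ ψ (0, 0) = w₃) ∧
      -- uniqueness on U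
      (∀ f' ψ' : ℝ × ℝ → Fin 3 → ℝ,
        (ContDiffOn ℝ (⊤ : ℕ∞) f' U ∧ ContDiffOn ℝ (⊤ : ℕ∞) ψ' U ∧
          (∀ q ∈ U,
            mink (pu f' q) (pu f' q) = E q ∧ mink (pu f' q) (pv f' q) = 0 ∧
            mink (pv f' q) (pv f' q) = G q ∧ mink (ψ' q) (ψ' q) = 0 ∧
            mink (ψ' q) (pu f' q) = 0 ∧ mink (ψ' q) (pv f' q) = 1 ∧
            mink (pu (pu f') q) (ψ' q) = X q ∧ mink (pv (pu f') q) (ψ' q) = Y q ∧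
            mink (pv (pv f') q) (ψ' q) = Z q) ∧
          f' (0, 0) = 0 ∧
          pu f' (0, 0) = w₁ ∧ pv f' (0, 0) = w₂ ∧ ψ' (0, 0) = w₃) →
        ∀ q ∈ U, f' q = f q ∧ ψ' q = ψ q) := by
  have hE0 : ∀ q ∈ U, E q ≠ 0 := fun q hq => (hEpos q hq).ne'
  choose f p r s hf hs hfr hf0 hp0 hr0 hs0 using fun k : Fin 3 =>
    exists_isFrameCoordAt hU hsc hE hG hX hY hZ hE0 hC1 hC2 hGauss h00 ![0, w₁ k, w₂ k, w₃ k]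
  have hgram0 : HasFrameGram (E (0, 0)) (G (0, 0)) w₁ w₂ w₃ := by
    rw [hE1, hG0]
    exact ⟨hw11, hw12, hw22, hw33, mink_comm w₃ w₁ ▸ hw13, mink_comm w₃ w₂ ▸ hw23⟩
  have hp0' : (fun k => p k (0, 0)) = w₁ := funext hp0
  have hr0' : (fun k => r k (0, 0)) = w₂ := funext hr0
  have hs0' : (fun k => s k (0, 0)) = w₃ := funext hs0
  have hdf : ∀ q ∈ U, HasPartialsAt (fun x k => f k x) (fun k => p k q) (fun k => r k q) q :=
    fun q hq => hasPartialsAt_pi.2 fun k => (hfr k q hq).1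
  have hframe : ∀ q ∈ U, ∀ k, IsFrameCoordAt E G X Y Z (p k) (r k) (s k) q :=
    fun q hq k => (hfr k q hq).2
  have hgram : ∀ q ∈ U, HasFrameGram (E q) (G q) (fun k => p k q) (fun k => r k q)
      (fun k => s k q) := fun q hq =>
    (hasFrameGram_iff_frameForm (hE0 q hq)).2 <|
      frameForm_eq_of_isFrameCoordAt (P := fun x k => p k x) (Q := fun x k => r k x)
        (S := fun x k => s k x) (P' := fun x k => p k x) (Q' := fun x k => r k x)
        (S' := fun x k => s k x) hU hconn.isPreconnected hE hG hE0 hframe hframe h00 rfl rfl rfl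
        (by simpa only [hp0', hr0', hs0'] using hgram0) hq
  refine ⟨fun x k => f k x, fun x k => s k x,
    ⟨contDiffOn_pi.2 hf, contDiffOn_pi.2 hs, fun q hq => ?_, funext hf0, ?_, ?_, hs0'⟩, ?_⟩
  · obtain ⟨g1, g2, g3, g4, g5, g6⟩ := hgram q hq
    have hev : ∀ᶠ x in nhds q, x ∈ U := hU.mem_nhds hq
    have dP : HasPartialsAt (pu fun x k => f k x) _ _ q :=
      (hasPartialsAt_pi.2 fun k => (hframe q hq k).fst).congr
        (hev.mono fun x hx => (hdf x hx).pu_eq) rfl rfl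
    have dQ : HasPartialsAt (pv fun x k => f k x) _ _ q :=
      (hasPartialsAt_pi.2 fun k => (hframe q hq k).snd).congr
        (hev.mono fun x hx => (hdf x hx).pv_eq) rfl rfl
    have key : ∀ a b c : ℝ, mink (fun k => a * p k q + b * r k q + c * s k q)
        (fun k => s k q) = b := fun a b c => by
      unfold mink at g4 g5 g6 ⊢
      linear_combination a * g5 + b * g6 + c * g4
    rw [(hdf q hq).pu_eq, (hdf q hq).pv_eq, dP.pu_eq, dP.pv_eq, dQ.pv_eq]
    exact ⟨g1, g2, g3, g4, g5, g6, key _ _ _, key _ _ _, key _ _ _⟩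
  · rw [(hdf _ h00).pu_eq, hp0']
  · rw [(hdf _ h00).pv_eq, hr0']
  · rintro f' ψ' ⟨hf', hψ', hcond, hf'0, hp', hr', hs'⟩
    have hgram' : ∀ q ∈ U, HasFrameGram (E q) (G q) (pu f' q) (pv f' q) (ψ' q) := fun q hq =>
      have ⟨g1, g2, g3, g4, g5, g6, _⟩ := hcond q hq
      ⟨g1, g2, g3, g4, g5, g6⟩
    have hframe' : ∀ q ∈ U, ∀ k, IsFrameCoordAt E G X Y Z (fun x => pu f' x k)
        (fun x => pv f' x k) (fun x => ψ' x k) q := fun q hq =>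
      have ⟨_, _, _, _, _, _, hX', hY', hZ'⟩ := hcond q hq
      isFrameCoordAt_of_hasFrameGram hU hE hG hE0 hf' hψ' hgram' hq hX' hY' hZ'
    have heq : ∀ q ∈ U, pu f' q = (fun k => p k q) ∧ pv f' q = (fun k => r k q) ∧
        ψ' q = fun k => s k q := fun q hq =>
      (hgram q hq).eq_of_frameForm (hE0 q hq) <|
        frameForm_eq_of_isFrameCoordAt (P := fun x k => p k x) (Q := fun x k => r k x)
          (S := fun x k => s k x) (P' := pu f') (Q' := pv f') (S' := ψ') hU hconn.isPreconnected
          hE hG hE0 hframe hframe' h00 (hp'.trans hp0'.symm) (hr'.trans hr0'.symm)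
          (hs'.trans hs0'.symm) (hgram _ h00) hq
    refine fun q hq => ⟨?_, (heq q hq).2.2⟩
    have hdiff := eq_of_hasPartialsAt_zero hU hconn.isPreconnected (fun x hx =>
      ((hf'.hasPartialsAt hU hx).sub (hdf x hx)).congr .rfl
        (sub_eq_zero.2 (heq x hx).1).symm (sub_eq_zero.2 (heq x hx).2.1).symm) hq h00
    refine sub_eq_zero.1 (hdiff.trans (sub_eq_zero.2 ?_))
    exact hf'0.trans (funext hf0).symm
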